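/- Let A be a discrete probability distribution supported on k points in ℝ with all weights equal to 1/k, and suppose A matches the first 4t moments of N(0,1) exactly, i.e., E_{x~A}[x^i] = E_{x~N(0,1)}[x^i] for all 1 ≤ i ≤ 4t. Then t ≤ C·log k for some absolute constant C. -/

import Mathlib

open MeasureTheory ProbabilityTheory

lemma gamma_half_prod (m : ℕ) :
    Real.Gamma ((m : ℝ) + 1 / 2) * 2 ^ m
      = √Real.pi * ∏ j ∈ Finset.range m, (2 * (j : ℝ) + 1) := by
  induction m with
  | zero => simp only [Nat.cast_zero, zero_add, Real.Gamma_one_half_eq]; simp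
  | succ m ih =>
    rw [Finset.prod_range_succ, ← mul_assoc, ← ih]
    have h : ((m + 1 : ℕ) : ℝ) + 1 / 2 = ((m : ℝ) + 1 / 2) + 1 := by push_cast; ring
    rw [h, Real.Gamma_add_one (by positivity)]
    ring

lemma gauss_moment (m : ℕ) :
    ∫ x, x ^ (2 * m) ∂(gaussianReal 0 1) = ∏ j ∈ Finset.range m, (2 * (j : ℝ) + 1) := by
  rw [integral_gaussianReal_eq_integral_smul one_ne_zero]
  have h1 : ∀ x : ℝ, gaussianPDFReal 0 1 x • x ^ (2 * m)
      = (√(2 * Real.pi))⁻¹ *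
        (fun y : ℝ => y ^ ((2 * m : ℕ) : ℝ) * Real.exp (-(1 / 2) * y ^ (2 : ℝ))) |x| := by
    intro x
    have e : |x| ^ (2 * m) = x ^ (2 * m) := (even_two_mul m).pow_abs x
    simp only [gaussianPDFReal, smul_eq_mul, Real.rpow_natCast, Real.rpow_two, sq_abs, e]
    have : -(x - 0) ^ 2 / (2 * ((1 : NNReal) : ℝ)) = -(1 / 2) * x ^ 2 := by
      rw [NNReal.coe_one]; ring
    rw [this, NNReal.coe_one]
    ring_nf
  simp_rw [h1]
  rw [integral_const_mul, integral_comp_abs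
      (f := fun y : ℝ => y ^ ((2 * m : ℕ) : ℝ) * Real.exp (-(1 / 2) * y ^ (2 : ℝ))),
    integral_rpow_mul_exp_neg_mul_rpow (by norm_num)
      (by have : (0 : ℝ) ≤ ((2 * m : ℕ) : ℝ) := by positivity
          linarith) (by norm_num)]
  have h2 : (((2 * m : ℕ) : ℝ) + 1) / 2 = (m : ℝ) + 1 / 2 := by push_cast; ring
  have h3 : ((1 : ℝ) / 2) ^ (-(((2 * m : ℕ) : ℝ) + 1) / 2) = 2 ^ m * √2 := by
    rw [neg_div, h2, one_div, Real.inv_rpow (by norm_num), Real.rpow_neg (by norm_num), inv_inv,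
      Real.rpow_add (by norm_num), Real.rpow_natCast, ← one_div, Real.sqrt_eq_rpow]
  have h4 := gamma_half_prod m
  rw [h3, h2, Real.sqrt_mul (by norm_num)]
  have hp : √Real.pi ≠ 0 := by have := Real.pi_pos; positivity
  have h5 : √(2 : ℝ) ≠ 0 := by positivity
  calc _ = (√Real.pi)⁻¹ * (Real.Gamma ((m : ℝ) + 1 / 2) * 2 ^ m) := by
        field_simp
    _ = _ := by rw [h4]; field_simp

lemma prod_ratio (t : ℕ) :
    2 ^ t * (∏ j ∈ Finset.range t, (2 * (j : ℝ) + 1)) ^ 2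
      ≤ ∏ j ∈ Finset.range (2 * t), (2 * (j : ℝ) + 1) := by
  have hP : 0 ≤ ∏ j ∈ Finset.range t, (2 * (j : ℝ) + 1) :=
    Finset.prod_nonneg fun j _ => by positivity
  rw [two_mul t, Finset.prod_range_add, sq, mul_left_comm]
  refine mul_le_mul_of_nonneg_left ?_ hP
  have : (2 : ℝ) ^ t = ∏ j ∈ Finset.range t, (2 : ℝ) := by simp
  rw [this, ← Finset.prod_mul_distrib]
  refine Finset.prod_le_prod (fun j _ => by positivity) fun j hj => ?_
  have : (j : ℝ) + 1 ≤ t := by exact_mod_cast Finset.mem_range.mp hj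
  push_cast
  linarith

/-- If the uniform distribution on `k` points matches the first `4t` moments of `N(0,1)`
exactly, then `t ≤ C log k` for an absolute constant `C`. -/
theorem uniform_moment_matching_bound :
    ∃ C : ℝ, 0 < C ∧ ∀ (k t : ℕ) (S : Finset ℝ),
      S.card = k → 0 < t →
      (∀ i : ℕ, 1 ≤ i → i ≤ 4 * t →
        (∑ x ∈ S, x ^ i) / (k : ℝ) = ∫ x, x ^ i ∂(gaussianReal 0 1)) →
      (t : ℝ) ≤ C * Real.log k := by
  have hl : 0 < Real.log 2 := Real.log_pos (by norm_num)
  refine ⟨(Real.log 2)⁻¹, by positivity, ?_⟩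
  intro k t S _ ht h
  have a := h (2 * t) (by omega) (by omega)
  have b := h (2 * (2 * t)) (by omega) (by omega)
  rw [gauss_moment] at a b
  have r := prod_ratio t
  have hP : 0 < ∏ j ∈ Finset.range t, (2 * (j : ℝ) + 1) :=
    Finset.prod_pos fun j _ => by positivity
  rw [← b] at r
  rw [← a] at r hP
  have hk : (0 : ℝ) < k := by
    rcases Nat.eq_zero_or_pos k with rfl | hk
    · simp at hP
    · exact_mod_cast hk
  have hs : ∑ x ∈ S, x ^ (2 * (2 * t)) ≤ (∑ x ∈ S, x ^ (2 * t)) ^ 2 := by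
    have := Finset.sum_sq_le_sq_sum_of_nonneg (s := S) (f := fun x : ℝ => x ^ (2 * t))
      (fun x _ => (even_two_mul t).pow_nonneg x)
    refine le_trans (le_of_eq ?_) this
    refine Finset.sum_congr rfl fun x _ => ?_
    rw [← pow_mul, mul_comm]
  set A := ∑ x ∈ S, x ^ (2 * t)
  have hb : (∑ x ∈ S, x ^ (2 * (2 * t))) / (k : ℝ) ≤ k * (A / k) ^ 2 := by
    have : (k : ℝ) * (A / k) ^ 2 = A ^ 2 / k := by field_simp
    rw [this]
    gcongr
  have h2 : (2 : ℝ) ^ t ≤ k := le_of_mul_le_mul_right (r.trans hb) (by positivity)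
  have h3 := Real.log_le_log (by positivity) h2
  rw [Real.log_pow] at h3
  rw [inv_mul_eq_div, le_div_iff₀ hl]
  exact h3
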